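/- arXiv:2103.04231 — 5 statements merged into one kernel-verified Lean document; each statement's English description precedes it below -/
import Mathlib

section
/- For every integer m ≥ 1, all reals θ > 0, a > −1, and all x, y > 0, one has K₀₁(x,y) − K₁₀(y,x) = v(x)·w(y). -/
open Finset MeasureTheory Set

noncomputable section

/-- The parameter `α = 2(a+1)/θ − 1`. -/
def alp (θ a : ℝ) : ℝ := 2 * (a + 1) / θ - 1

/-- The upper incomplete Gamma function `Γ(s,x) = ∫_x^∞ t^{s−1} e^{−t} dt`. -/
def uGamma (s x : ℝ) : ℝ := ∫ t in Ioi x, t ^ (s - 1) * Real.exp (-t)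

/-- The biorthogonal polynomial `p_j(x^θ)` of the quantum interpolating ensemble. -/
def pPoly (θ a : ℝ) (j : ℕ) (x : ℝ) : ℝ :=
  ∑ k ∈ Finset.range (j + 1),
    Real.sqrt 2 * (-1 : ℝ) ^ (k + j) * Real.Gamma ((k : ℝ) + j + alp θ a + 1)
        * x ^ (θ * k)
      / (Real.Gamma (θ * k + a + 1) * Real.Gamma ((k : ℝ) + alp θ a + 1)
          * (Nat.factorial (j - k)) * (Nat.factorial k))

/-- The dual biorthogonal polynomial `q_j(y^θ)` of the quantum interpolating ensemble. -/
def qPoly (θ a : ℝ) (j : ℕ) (y : ℝ) : ℝ :=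
  ∑ k ∈ Finset.range (j + 1),
    Real.sqrt 2 * (-1 : ℝ) ^ (k + j) * (θ * j + a + 1)
        * Real.Gamma ((k : ℝ) + j + alp θ a + 1) * y ^ (θ * k)
      / (Real.Gamma (θ * k + a + 2) * Real.Gamma ((k : ℝ) + alp θ a + 1)
          * (Nat.factorial (j - k)) * (Nat.factorial k))

/-- The kernel `K₀₀(x,y) = Σ_{k=0}^{m−1} p_k(x^θ) q_k(y^θ)`. -/
def K00 (m : ℕ) (θ a : ℝ) (x y : ℝ) : ℝ :=
  ∑ k ∈ Finset.range m, pPoly θ a k x * qPoly θ a k y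

/-- The factor `w(x)`. -/
def wFun (m : ℕ) (θ a : ℝ) (x : ℝ) : ℝ :=
  θ * ∑ k ∈ Finset.range m,
    (-1 : ℝ) ^ k * Real.Gamma ((k : ℝ) + alp θ a + m + 1) * x ^ (θ * k)
      / (Real.Gamma (θ * k + a + 2) * Real.Gamma ((k : ℝ) + alp θ a + 1)
          * (Nat.factorial (m - 1 - k)) * (Nat.factorial k))

/-- The factor `v(x)`. -/
def vFun (m : ℕ) (θ a : ℝ) (x : ℝ) : ℝ :=
  Real.exp (-x) * x ^ a
    - θ * x ^ (2 * a + 1) * ∑ k ∈ Finset.range m,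
        (-1 : ℝ) ^ k * Real.Gamma ((k : ℝ) + alp θ a + m + 1)
            * uGamma (-(θ * k) - a) x * x ^ (θ * k)
          / ((θ * k + a + 1) * Real.Gamma ((k : ℝ) + alp θ a + 1)
              * (Nat.factorial (m - 1 - k)) * (Nat.factorial k))

/-- The kernel `K₀₁(x,y) = x^a e^{−x} ∫_0^∞ v^{a+1} e^{−v} K₀₀(y,v)/(x+v) dv`. -/
def K01 (m : ℕ) (θ a : ℝ) (x y : ℝ) : ℝ :=
  x ^ a * Real.exp (-x)
    * ∫ v in Ioi (0 : ℝ), v ^ (a + 1) * Real.exp (-v) * K00 m θ a y v / (x + v)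

/-- The kernel `K₁₀(x,y) = y^{a+1} e^{−y} ∫_0^∞ u^a e^{−u} K₀₀(u,x)/(y+u) du`. -/
def K10 (m : ℕ) (θ a : ℝ) (x y : ℝ) : ℝ :=
  y ^ (a + 1) * Real.exp (-y)
    * ∫ u in Ioi (0 : ℝ), u ^ a * Real.exp (-u) * K00 m θ a u x / (y + u)

/-- The Cauchy–Laguerre weight `W(x,y) = x^a y^{a+1} e^{−x−y}/(x+y)`. -/
def Wwt (a : ℝ) (x y : ℝ) : ℝ := x ^ a * y ^ (a + 1) * Real.exp (-x - y) / (x + y)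

/-- The kernel `K₁₁(x,y)`. -/
def K11 (m : ℕ) (θ a : ℝ) (x y : ℝ) : ℝ :=
  x ^ a * y ^ (a + 1) * Real.exp (-x - y)
      * ∫ v in Ioi (0 : ℝ), ∫ u in Ioi (0 : ℝ),
          (v ^ a * Real.exp (-v) / (y + v)) * (u ^ (a + 1) * Real.exp (-u) / (x + u))
            * K00 m θ a v u
    - Wwt a x y

theorem integrableOn_rpow_mul_exp_neg_div_add {s x : ℝ} (hs : 0 < s) (hx : 0 < x) :
    IntegrableOn (fun v : ℝ => v ^ (s - 1) * Real.exp (-v) / (x + v)) (Ioi 0) := by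
  refine ((Real.GammaIntegral_convergent hs).const_mul x⁻¹).mono'
    (by fun_prop : Measurable _).aestronglyMeasurable
    ((ae_restrict_iff' measurableSet_Ioi).2 (.of_forall fun v hv => ?_))
  have hv : 0 < v := hv
  rw [Real.norm_of_nonneg (by positivity), mul_comm (Real.exp _), div_eq_inv_mul]
  gcongr
  linarith

theorem integral_rpow_mul_exp_neg_div_add_succ {s x : ℝ} (hs : 0 < s) (hx : 0 < x) :
    ∫ v in Ioi (0 : ℝ), v ^ s * Real.exp (-v) / (x + v)
      = Real.Gamma s - x * ∫ v in Ioi (0 : ℝ), v ^ (s - 1) * Real.exp (-v) / (x + v) := by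
  rw [Real.Gamma_eq_integral hs, ← integral_const_mul, ← integral_sub
    (Real.GammaIntegral_convergent hs) ((integrableOn_rpow_mul_exp_neg_div_add hs hx).const_mul x)]
  refine setIntegral_congr_fun measurableSet_Ioi fun v hv => ?_
  have hv : 0 < v := hv
  have hvs : v ^ s = v ^ (s - 1) * v := by
    rw [← Real.rpow_add_one hv.ne']
    ring_nf
  simp only [hvs]
  field_simp
  ring

/-- The Stieltjes transform of a Gamma density is an upper incomplete Gamma function. -/
theorem integral_rpow_mul_exp_neg_div_add {s x : ℝ} (hs : 0 < s) (hx : 0 < x) :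
    ∫ v in Ioi (0 : ℝ), v ^ (s - 1) * Real.exp (-v) / (x + v)
      = Real.Gamma s * Real.exp x * x ^ (s - 1) * uGamma (1 - s) x := by
  set F : ℝ → ℝ → ℝ := fun v t => v ^ (s - 1) * Real.exp (-((1 + v / x) * t)) with hF
  have hslice : ∀ v ∈ Ioi (0 : ℝ), IntegrableOn (F v) (Ioi x) := fun v hv => by
    have hv : 0 < v := hv
    have h := (integrableOn_exp_mul_Ioi (a := -(1 + v / x))
      (by have : 0 < v / x := by positivity
          linarith) x).const_mul (v ^ (s - 1))
    simpa only [hF, neg_mul, IntegrableOn] using h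
  have hinner : ∀ v ∈ Ioi (0 : ℝ), ∫ t in Ioi x, F v t
      = x * Real.exp (-x) * (v ^ (s - 1) * Real.exp (-v) / (x + v)) := fun v hv => by
    have hv : 0 < v := hv
    have h := integral_exp_mul_Ioi (a := -(1 + v / x))
      (by have : 0 < v / x := by positivity
          linarith) x
    simp only [neg_mul] at h
    simp only [hF]
    rw [integral_const_mul, h, show -((1 + v / x) * x) = -x + -v by field_simp; ring,
      Real.exp_add]
    field_simp
  have houter : ∀ t ∈ Ioi x, ∫ v in Ioi (0 : ℝ), F v t
      = Real.Gamma s * x ^ s * (t ^ (1 - s - 1) * Real.exp (-t)) := fun t ht => by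
    have ht : 0 < t := hx.trans ht
    have h := Real.integral_rpow_mul_exp_neg_mul_Ioi hs (r := t / x) (by positivity)
    have : ∀ v : ℝ, F v t = Real.exp (-t) * (v ^ (s - 1) * Real.exp (-(t / x * v))) := fun v => by
      simp only [hF]
      rw [show -((1 + v / x) * t) = -t + -(t / x * v) by ring, Real.exp_add]
      ring
    simp only [this]
    rw [integral_const_mul, h, one_div_div, Real.div_rpow hx.le ht.le,
      show 1 - s - 1 = -s by ring, Real.rpow_neg ht.le]
    ring
  have hcomb : IntegrableOn (fun v : ℝ => v ^ (s - 1) * Real.exp (-v) / (x + v)) (Ioi 0) :=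
    integrableOn_rpow_mul_exp_neg_div_add hs hx
  have hprod : Integrable (Function.uncurry F)
      ((volume.restrict (Ioi (0 : ℝ))).prod (volume.restrict (Ioi x))) := by
    have hmeas : Measurable (Function.uncurry F) := by
      simp only [hF, Function.uncurry_def]
      fun_prop
    rw [integrable_prod_iff hmeas.aestronglyMeasurable]
    refine ⟨(ae_restrict_iff' measurableSet_Ioi).2 (.of_forall hslice), ?_⟩
    refine (integrableOn_congr_fun (fun v hv => ?_) measurableSet_Ioi).2
      (hcomb.const_mul (x * Real.exp (-x)))
    rw [← hinner v hv]
    refine integral_congr_ae (.of_forall fun t => ?_)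
    have hv : 0 < v := hv
    simp only [Function.uncurry_apply_pair, hF]
    exact Real.norm_of_nonneg (by positivity)
  have hswap := integral_integral_swap hprod
  rw [setIntegral_congr_fun measurableSet_Ioi hinner,
    setIntegral_congr_fun measurableSet_Ioi houter, integral_const_mul, integral_const_mul] at hswap
  rw [uGamma]
  have hxs : x ^ s = x ^ (s - 1) * x := by
    rw [← Real.rpow_add_one hx.ne']
    ring_nf
  rw [hxs, Real.exp_neg] at hswap
  field_simp at hswap ⊢
  linarith

/-- The coefficients of `w` and `v`, with `b = α + 1`; the reciprocal Gamma function makes them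
vanish for `k ≥ m`. -/
def edgeCoeff (b : ℝ) (m k : ℕ) : ℝ :=
  (-1 : ℝ) ^ k * Real.Gamma (k + b + m) / (Real.Gamma (k + b) * k.factorial)
    * (Real.Gamma ((m : ℝ) - k))⁻¹

/-- The common coefficients of the biorthogonal polynomials `p_j` and `q_j`, up to `√2`,
with `b = α + 1`. -/
def polyCoeff (b : ℝ) (j k : ℕ) : ℝ :=
  (-1 : ℝ) ^ (k + j) * Real.Gamma (k + j + b) / (Real.Gamma (k + b) * k.factorial)
    * (Real.Gamma ((j : ℝ) - k + 1))⁻¹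

theorem inv_Gamma_eq_mul_inv_Gamma_add_one (z : ℝ) :
    (Real.Gamma z)⁻¹ = z * (Real.Gamma (z + 1))⁻¹ := by
  rcases eq_or_ne z 0 with rfl | hz
  · simp
  · rw [Real.Gamma_add_one hz, mul_inv, mul_inv_cancel_left₀ hz]

theorem inv_Gamma_natCast_sub (m k : ℕ) (h : k < m) :
    (Real.Gamma ((m : ℝ) - k))⁻¹ = ((m - 1 - k).factorial : ℝ)⁻¹ := by
  obtain ⟨n, rfl⟩ := Nat.exists_eq_add_of_lt h
  rw [← Real.Gamma_nat_eq_factorial, show k + n + 1 - 1 - k = n by omega]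
  push_cast
  ring_nf

theorem edgeCoeff_of_le {b : ℝ} {m k : ℕ} (h : m ≤ k) : edgeCoeff b m k = 0 := by
  obtain ⟨n, rfl⟩ := Nat.exists_eq_add_of_le h
  rw [edgeCoeff, show (m : ℝ) - (m + n : ℕ) = -n by push_cast; ring,
    Real.Gamma_neg_nat_eq_zero, inv_zero, mul_zero]

theorem polyCoeff_of_lt {b : ℝ} {j k : ℕ} (h : j < k) : polyCoeff b j k = 0 := by
  obtain ⟨n, rfl⟩ := Nat.exists_eq_add_of_lt h
  rw [polyCoeff, show (j : ℝ) - (j + n + 1 : ℕ) + 1 = -n by push_cast; ring,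
    Real.Gamma_neg_nat_eq_zero, inv_zero, mul_zero]

theorem mul_polyCoeff_mul_polyCoeff {b : ℝ} (hb : 0 < b) (j k l : ℕ) :
    (2 * j + b) * (k + l + b) * polyCoeff b j k * polyCoeff b j l
      = edgeCoeff b (j + 1) k * edgeCoeff b (j + 1) l - edgeCoeff b j k * edgeCoeff b j l := by
  have hk : Real.Gamma (k + b + (j + 1 : ℕ)) = (k + j + b) * Real.Gamma (k + j + b) := by
    rw [← Real.Gamma_add_one (by positivity)]
    push_cast
    ring_nf
  have hl : Real.Gamma (l + b + (j + 1 : ℕ)) = (l + j + b) * Real.Gamma (l + j + b) := by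
    rw [← Real.Gamma_add_one (by positivity)]
    push_cast
    ring_nf
  have hsq : ((-1 : ℝ) ^ j) ^ 2 = 1 := by rw [← pow_mul, mul_comm, pow_mul]; simp
  simp only [edgeCoeff, polyCoeff]
  rw [hk, hl, inv_Gamma_eq_mul_inv_Gamma_add_one ((j : ℝ) - k),
    inv_Gamma_eq_mul_inv_Gamma_add_one ((j : ℝ) - l),
    show ((j + 1 : ℕ) : ℝ) - k = j - k + 1 by push_cast; ring,
    show ((j + 1 : ℕ) : ℝ) - l = j - l + 1 by push_cast; ring,
    show (k : ℝ) + b + j = k + j + b by ring, show (l : ℝ) + b + j = l + j + b by ring,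
    pow_add, pow_add]
  linear_combination ((2 * j + b) * (k + l + b) * ((-1 : ℝ) ^ k * Real.Gamma (k + j + b)
    / (Real.Gamma (k + b) * k.factorial) * (Real.Gamma ((j : ℝ) - k + 1))⁻¹)
    * ((-1 : ℝ) ^ l * Real.Gamma (l + j + b)
    / (Real.Gamma (l + b) * l.factorial) * (Real.Gamma ((j : ℝ) - l + 1))⁻¹)) * hsq

/-- The Christoffel–Darboux identity for the coefficients. -/
theorem sum_polyCoeff_mul_polyCoeff {b : ℝ} (hb : 0 < b) (m k l : ℕ) :
    ∑ j ∈ Finset.range m, (2 * j + b) * polyCoeff b j k * polyCoeff b j l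
      = edgeCoeff b m k * edgeCoeff b m l / (k + l + b) := by
  rw [eq_div_iff (by positivity), Finset.sum_mul]
  have h := Finset.sum_range_sub (fun j => edgeCoeff b j k * edgeCoeff b j l) m
  simp only [edgeCoeff_of_le (Nat.zero_le _), zero_mul, sub_zero] at h
  rw [← h]
  refine Finset.sum_congr rfl fun j _ => ?_
  rw [← mul_polyCoeff_mul_polyCoeff hb]
  ring

theorem Gamma_add_natCast {s : ℝ} (hs : 0 < s) (m : ℕ) :
    Real.Gamma (s + m) = Real.Gamma s * ∏ i ∈ Finset.range m, (s + i) := by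
  induction m with
  | zero => simp
  | succ n ih =>
    rw [Finset.prod_range_succ, ← mul_assoc, ← ih, Nat.cast_succ, ← add_assoc,
      Real.Gamma_add_one (by positivity), mul_comm]

theorem prod_range_erase_sub (m k : ℕ) (h : k < m) :
    ∏ i ∈ (Finset.range m).erase k, ((i : ℝ) - k)
      = (-1 : ℝ) ^ k * k.factorial * (m - 1 - k).factorial := by
  induction m, h using Nat.le_induction with
  | base =>
    rw [Finset.range_add_one, Finset.erase_insert Finset.notMem_range_self]
    simp only [Nat.succ_eq_add_one, add_tsub_cancel_right, tsub_self, Nat.factorial_zero,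
      Nat.cast_one, mul_one]
    rw [← Finset.prod_range_reflect, ← Finset.prod_range_add_one_eq_factorial, Nat.cast_prod,
      ← Finset.card_range k, ← Finset.prod_const, Finset.card_range, ← Finset.prod_mul_distrib]
    refine Finset.prod_congr rfl fun i hi => ?_
    have hi := Finset.mem_range.1 hi
    rw [Nat.sub_sub, Nat.cast_sub (by omega)]
    push_cast
    ring
  | succ n hn ih =>
    have hn' : k < n := hn
    rw [Finset.range_add_one, Finset.erase_insert_of_ne (by omega), Finset.prod_insert (by simp), ih,
      show n + 1 - 1 - k = (n - 1 - k) + 1 by omega, Nat.factorial_succ,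
      show n - 1 - k + 1 = n - k by omega]
    push_cast [Nat.cast_sub hn'.le]
    ring

theorem edgeCoeff_eq {b : ℝ} (hb : 0 < b) {m k : ℕ} (h : k < m) :
    edgeCoeff b m k = (∏ i ∈ Finset.range m, (k + b + i))
      * ∏ i ∈ (Finset.range m).erase k, ((i : ℝ) - k)⁻¹ := by
  have hG : Real.Gamma (k + b) ≠ 0 := (Real.Gamma_pos_of_pos (by positivity)).ne'
  have hsq : ((-1 : ℝ) ^ k) ^ 2 = 1 := by rw [← pow_mul, mul_comm, pow_mul]; simp
  rw [Finset.prod_inv_distrib, prod_range_erase_sub m k h, edgeCoeff,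
    inv_Gamma_natCast_sub m k h, Gamma_add_natCast (by positivity)]
  field_simp
  rw [hsq]

/-- Partial fractions for `∏ (s - b - i) / (s + i)`. -/
theorem sum_edgeCoeff_div {b : ℝ} (hb : 0 < b) (m : ℕ) {s : ℝ} (hs : 0 < s) :
    ∑ k ∈ Finset.range m, edgeCoeff b m k / (k + s)
      = (∏ i ∈ Finset.range m, (b + i - s) / (s + i)) - (-1) ^ m := by
  have hinj : Set.InjOn (fun i : ℕ => -(i : ℝ)) (Finset.range m) := fun i _ j _ h => by
    simpa using h
  set N := Lagrange.nodal (Finset.range m) (fun i : ℕ => -(i : ℝ)) with hN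
  set B := Lagrange.nodal (Finset.range m) (fun i : ℕ => b + (i : ℝ)) with hB
  have hdeg : (B - N).degree < (Finset.range m).card := by
    have h := Polynomial.degree_sub_lt_left (p := B) (q := N)
      (by rw [hB, hN, Lagrange.degree_nodal, Lagrange.degree_nodal]) Lagrange.nodal_ne_zero
      (by rw [Lagrange.nodal_monic.leadingCoeff, Lagrange.nodal_monic.leadingCoeff])
    rwa [hB, Lagrange.degree_nodal] at h
  have hne : ∀ i ∈ Finset.range m, s ≠ -(i : ℝ) := fun i _ h => by
    have : (0 : ℝ) ≤ i := Nat.cast_nonneg i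
    linarith
  have hint := congrArg (Polynomial.eval s) (Lagrange.eq_interpolate hinj hdeg)
  rw [Lagrange.eval_interpolate_not_at_node _ hne, ← hN, Polynomial.eval_sub] at hint
  have hN0 : Polynomial.eval s N ≠ 0 := Lagrange.eval_nodal_not_at_node hne
  have hsum : ∀ k ∈ Finset.range m,
      Lagrange.nodalWeight (Finset.range m) (fun i : ℕ => -(i : ℝ)) k * (s - -(k : ℝ))⁻¹
        * Polynomial.eval (-(k : ℝ)) (B - N) = (-1) ^ m * (edgeCoeff b m k / (k + s)) := by
    intro k hk
    have hNk : Polynomial.eval (-(k : ℝ)) N = 0 :=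
      Lagrange.eval_nodal_at_node (v := fun i : ℕ => -(i : ℝ)) hk
    have hBk : Polynomial.eval (-(k : ℝ)) B
        = (-1) ^ m * ∏ i ∈ Finset.range m, (k + b + i) := by
      rw [hB, Lagrange.eval_nodal, ← Finset.card_range m, ← Finset.prod_const, Finset.card_range,
        ← Finset.prod_mul_distrib]
      exact Finset.prod_congr rfl fun i _ => by ring
    have hw : Lagrange.nodalWeight (Finset.range m) (fun i : ℕ => -(i : ℝ)) k
        = ∏ i ∈ (Finset.range m).erase k, ((i : ℝ) - k)⁻¹ := by
      rw [Lagrange.nodalWeight]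
      exact Finset.prod_congr rfl fun i _ => by ring_nf
    rw [Polynomial.eval_sub, hNk, hBk, sub_zero, hw, edgeCoeff_eq hb (Finset.mem_range.1 hk)]
    ring
  rw [Finset.sum_congr rfl hsum, ← Finset.mul_sum] at hint
  have hprod : ∏ i ∈ Finset.range m, (b + i - s) / (s + i)
      = (-1) ^ m * (Polynomial.eval s B / Polynomial.eval s N) := by
    rw [hB, hN, Lagrange.eval_nodal, Lagrange.eval_nodal, ← Finset.prod_div_distrib,
      ← Finset.card_range m, ← Finset.prod_const, Finset.card_range, ← Finset.prod_mul_distrib]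
    refine Finset.prod_congr rfl fun i _ => ?_
    rw [sub_neg_eq_add]
    ring
  have hsq : ((-1 : ℝ) ^ m) ^ 2 = 1 := by rw [← pow_mul, mul_comm, pow_mul]; simp
  rw [hprod]
  field_simp
  linear_combination (-(-1) ^ m) * hint - (Polynomial.eval s N *
    ∑ k ∈ Finset.range m, edgeCoeff b m k / (k + s)) * hsq

theorem sum_edgeCoeff_div_mul {b : ℝ} (hb : 0 < b) {m l : ℕ} (hl : l < m) :
    ∑ k ∈ Finset.range m, edgeCoeff b m k * (l + b / 2) / ((k + l + b) * (k + b / 2)) = 1 := by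
  have h1 := sum_edgeCoeff_div hb m (s := b / 2) (by positivity)
  have h2 := sum_edgeCoeff_div hb m (s := l + b) (by positivity)
  rw [Finset.prod_eq_one fun i _ => by
    rw [show b + i - b / 2 = b / 2 + i by ring, div_self (by positivity)]] at h1
  rw [Finset.prod_eq_zero (Finset.mem_range.2 hl) (by
    rw [show b + (l : ℝ) - (l + b) = 0 by ring, zero_div])] at h2
  have h : ∑ k ∈ Finset.range m, edgeCoeff b m k * (l + b / 2) / ((k + l + b) * (k + b / 2))
      = ∑ k ∈ Finset.range m, edgeCoeff b m k / (k + b / 2)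
        - ∑ k ∈ Finset.range m, edgeCoeff b m k / (k + (l + b)) := by
    rw [← Finset.sum_sub_distrib]
    refine Finset.sum_congr rfl fun k _ => ?_
    field_simp
    ring
  rw [h, h1, h2]
  ring

theorem sum_range_succ_eq_of_lt {f g : ℕ → ℝ} {j m : ℕ} (hj : j < m)
    (hfg : ∀ k ≤ j, f k = g k) (hg : ∀ k, j < k → g k = 0) :
    ∑ k ∈ Finset.range (j + 1), f k = ∑ k ∈ Finset.range m, g k := by
  rw [Finset.sum_congr rfl fun k hk => hfg k (Nat.lt_succ_iff.1 (Finset.mem_range.1 hk))]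
  exact Finset.sum_subset (Finset.range_mono hj) fun k _ hk =>
    hg k (by simpa using hk)

theorem inv_Gamma_natCast_sub_add_one {j k : ℕ} (h : k ≤ j) :
    (Real.Gamma ((j : ℝ) - k + 1))⁻¹ = ((j - k).factorial : ℝ)⁻¹ := by
  rw [← Real.Gamma_nat_eq_factorial, Nat.cast_sub h]

theorem pPoly_eq (θ a x : ℝ) {j m : ℕ} (hj : j < m) :
    pPoly θ a j x = ∑ k ∈ Finset.range m, Real.sqrt 2 * polyCoeff (alp θ a + 1) j k
      * x ^ (θ * k) / Real.Gamma (θ * k + a + 1) := by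
  refine sum_range_succ_eq_of_lt hj (fun k hk => ?_) fun k hk => ?_
  · rw [polyCoeff, inv_Gamma_natCast_sub_add_one hk, ← add_assoc, ← add_assoc]
    ring
  · simp [polyCoeff_of_lt hk]

theorem qPoly_eq (θ a y : ℝ) {j m : ℕ} (hj : j < m) :
    qPoly θ a j y = ∑ k ∈ Finset.range m, Real.sqrt 2 * (θ * j + a + 1)
      * polyCoeff (alp θ a + 1) j k * y ^ (θ * k) / Real.Gamma (θ * k + a + 2) := by
  refine sum_range_succ_eq_of_lt hj (fun k hk => ?_) fun k hk => ?_
  · rw [polyCoeff, inv_Gamma_natCast_sub_add_one hk, ← add_assoc, ← add_assoc]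
    ring
  · simp [polyCoeff_of_lt hk]

theorem mul_alp_add_one {θ : ℝ} (a : ℝ) (hθ : 0 < θ) : θ * (alp θ a + 1) = 2 * (a + 1) := by
  rw [alp]
  field_simp
  ring

theorem alp_add_one_pos {θ a : ℝ} (hθ : 0 < θ) (ha : -1 < a) : 0 < alp θ a + 1 := by
  have : 0 < a + 1 := by linarith
  rw [alp, sub_add_cancel]
  positivity

theorem K00_eq (m : ℕ) {θ a : ℝ} (hθ : 0 < θ) (ha : -1 < a) (x y : ℝ) :
    K00 m θ a x y = ∑ k ∈ Finset.range m, ∑ l ∈ Finset.range m,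
      θ * edgeCoeff (alp θ a + 1) m k * edgeCoeff (alp θ a + 1) m l / (k + l + (alp θ a + 1))
        * (x ^ (θ * k) / Real.Gamma (θ * k + a + 1))
        * (y ^ (θ * l) / Real.Gamma (θ * l + a + 2)) := by
  have hterm : ∀ j ∈ Finset.range m, pPoly θ a j x * qPoly θ a j y
      = ∑ k ∈ Finset.range m, ∑ l ∈ Finset.range m,
        θ * ((2 * j + (alp θ a + 1)) * polyCoeff (alp θ a + 1) j k * polyCoeff (alp θ a + 1) j l)
          * (x ^ (θ * k) / Real.Gamma (θ * k + a + 1))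
          * (y ^ (θ * l) / Real.Gamma (θ * l + a + 2)) := by
    intro j hj
    have hj := Finset.mem_range.1 hj
    rw [pPoly_eq θ a x hj, qPoly_eq θ a y hj, Finset.sum_mul_sum]
    refine Finset.sum_congr rfl fun k _ => Finset.sum_congr rfl fun l _ => ?_
    have h2 : Real.sqrt 2 ^ 2 = 2 := Real.sq_sqrt zero_le_two
    have hc : θ * j + a + 1 = θ * (2 * j + (alp θ a + 1)) / 2 := by
      linear_combination (-1 / 2) * mul_alp_add_one a hθ
    rw [hc]
    linear_combination (polyCoeff (alp θ a + 1) j k * polyCoeff (alp θ a + 1) j l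
      * (x ^ (θ * k) / Real.Gamma (θ * k + a + 1)) * (y ^ (θ * l) / Real.Gamma (θ * l + a + 2))
      * (θ * (2 * j + (alp θ a + 1)) / 2)) * h2
  rw [K00, Finset.sum_congr rfl hterm, Finset.sum_comm]
  refine Finset.sum_congr rfl fun k _ => ?_
  rw [Finset.sum_comm]
  refine Finset.sum_congr rfl fun l _ => ?_
  rw [← Finset.sum_mul, ← Finset.sum_mul, ← Finset.mul_sum,
    sum_polyCoeff_mul_polyCoeff (alp_add_one_pos hθ ha)]
  ring

theorem wFun_eq (m : ℕ) (θ a y : ℝ) :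
    wFun m θ a y = θ * ∑ k ∈ Finset.range m,
      edgeCoeff (alp θ a + 1) m k * y ^ (θ * k) / Real.Gamma (θ * k + a + 2) := by
  rw [wFun]
  congr 1
  refine Finset.sum_congr rfl fun k hk => ?_
  rw [edgeCoeff, inv_Gamma_natCast_sub m k (Finset.mem_range.1 hk), ← add_assoc,
    add_right_comm _ 1 (m : ℝ)]
  ring

theorem vFun_eq (m : ℕ) (θ a x : ℝ) :
    vFun m θ a x = Real.exp (-x) * x ^ a - θ * x ^ (2 * a + 1) * ∑ k ∈ Finset.range m,
      edgeCoeff (alp θ a + 1) m k * uGamma (-(θ * k) - a) x * x ^ (θ * k) / (θ * k + a + 1) := by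
  rw [vFun]
  congr 2
  refine Finset.sum_congr rfl fun k hk => ?_
  rw [edgeCoeff, inv_Gamma_natCast_sub m k (Finset.mem_range.1 hk), ← add_assoc,
    add_right_comm _ 1 (m : ℝ)]
  simp only [div_eq_mul_inv, mul_inv]
  ring

/-- The normalized Stieltjes transform `(1/Γ(s)) ∫₀^∞ v^{s−1} e^{−v}/(x+v) dv`. -/
def gammaStieltjes (s x : ℝ) : ℝ :=
  (∫ v in Ioi (0 : ℝ), v ^ (s - 1) * Real.exp (-v) / (x + v)) / Real.Gamma s

theorem gammaStieltjes_eq {s x : ℝ} (hs : 0 < s) (hx : 0 < x) :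
    gammaStieltjes s x = Real.exp x * x ^ (s - 1) * uGamma (1 - s) x := by
  have := (Real.Gamma_pos_of_pos hs).ne'
  rw [gammaStieltjes, integral_rpow_mul_exp_neg_div_add hs hx]
  field_simp

theorem gammaStieltjes_add_one {s x : ℝ} (hs : 0 < s) (hx : 0 < x) :
    gammaStieltjes (s + 1) x = (1 - x * gammaStieltjes s x) / s := by
  have := (Real.Gamma_pos_of_pos hs).ne'
  rw [gammaStieltjes, gammaStieltjes, add_sub_cancel_right,
    integral_rpow_mul_exp_neg_div_add_succ hs hx, Real.Gamma_add_one hs.ne']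
  field_simp

theorem integral_sum_sum_mul_rpow_mul_exp_neg_div_add {ι κ : Type*} (S : Finset ι) (T : Finset κ)
    (C : ι → κ → ℝ) {r : ι → κ → ℝ} (hr : ∀ i j, 0 < r i j) {x : ℝ} (hx : 0 < x) :
    ∫ v in Ioi (0 : ℝ), ∑ i ∈ S, ∑ j ∈ T,
        C i j * (v ^ (r i j - 1) * Real.exp (-v) / (x + v)) / Real.Gamma (r i j)
      = ∑ i ∈ S, ∑ j ∈ T, C i j * gammaStieltjes (r i j) x := by
  have hint : ∀ i j, IntegrableOn (fun v : ℝ => C i j * (v ^ (r i j - 1) * Real.exp (-v) / (x + v))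
      / Real.Gamma (r i j)) (Ioi 0) := fun i j =>
    ((integrableOn_rpow_mul_exp_neg_div_add (hr i j) hx).const_mul _).div_const _
  rw [integral_finsetSum _ fun i _ => integrable_finsetSum _ fun j _ => hint i j]
  refine Finset.sum_congr rfl fun i _ => ?_
  rw [integral_finsetSum _ fun j _ => hint i j]
  refine Finset.sum_congr rfl fun j _ => ?_
  rw [integral_div, integral_const_mul, gammaStieltjes, mul_div_assoc]

theorem K01_eq (m : ℕ) {θ a : ℝ} (hθ : 0 < θ) (ha : -1 < a) {x : ℝ} (hx : 0 < x) (y : ℝ) :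
    K01 m θ a x y = x ^ a * Real.exp (-x) * ∑ k ∈ Finset.range m, ∑ l ∈ Finset.range m,
      θ * edgeCoeff (alp θ a + 1) m k * edgeCoeff (alp θ a + 1) m l / (k + l + (alp θ a + 1))
        * (y ^ (θ * k) / Real.Gamma (θ * k + a + 1)) * gammaStieltjes (θ * l + a + 2) x := by
  have hpos : ∀ l : ℕ, 0 < θ * l + a + 2 := fun l => by
    have : 0 ≤ θ * l := by positivity
    linarith
  rw [K01, ← integral_sum_sum_mul_rpow_mul_exp_neg_div_add _ _ _ (fun _ l => hpos l) hx]
  congr 1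
  refine setIntegral_congr_fun measurableSet_Ioi fun v hv => ?_
  have hv : 0 < v := hv
  simp only [K00_eq m hθ ha, Finset.mul_sum, Finset.sum_div]
  refine Finset.sum_congr rfl fun k _ => Finset.sum_congr rfl fun l _ => ?_
  rw [show θ * l + a + 2 - 1 = (a + 1) + θ * l by ring, Real.rpow_add hv (a + 1)]
  ring

theorem K10_eq (m : ℕ) {θ a : ℝ} (hθ : 0 < θ) (ha : -1 < a) {x : ℝ} (hx : 0 < x) (y : ℝ) :
    K10 m θ a y x = x ^ (a + 1) * Real.exp (-x) * ∑ k ∈ Finset.range m, ∑ l ∈ Finset.range m,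
      θ * edgeCoeff (alp θ a + 1) m k * edgeCoeff (alp θ a + 1) m l / (k + l + (alp θ a + 1))
        * (y ^ (θ * l) / Real.Gamma (θ * l + a + 2)) * gammaStieltjes (θ * k + a + 1) x := by
  have hpos : ∀ k : ℕ, 0 < θ * k + a + 1 := fun k => by
    have : 0 ≤ θ * k := by positivity
    linarith
  rw [K10, ← integral_sum_sum_mul_rpow_mul_exp_neg_div_add _ _ _ (fun k _ => hpos k) hx]
  congr 1
  refine setIntegral_congr_fun measurableSet_Ioi fun v hv => ?_
  have hv : 0 < v := hv
  simp only [K00_eq m hθ ha, Finset.mul_sum, Finset.sum_div]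
  refine Finset.sum_congr rfl fun k _ => Finset.sum_congr rfl fun l _ => ?_
  rw [show θ * k + a + 1 - 1 = a + θ * k by ring, Real.rpow_add hv a]
  ring

theorem vFun_eq_gammaStieltjes (m : ℕ) {θ a : ℝ} (hθ : 0 < θ) (ha : -1 < a) {x : ℝ}
    (hx : 0 < x) :
    vFun m θ a x = x ^ a * Real.exp (-x) * (1 - θ * x * ∑ k ∈ Finset.range m,
      edgeCoeff (alp θ a + 1) m k * gammaStieltjes (θ * k + a + 1) x / (θ * k + a + 1)) := by
  have hterm : ∀ k ∈ Finset.range m, edgeCoeff (alp θ a + 1) m k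
        * gammaStieltjes (θ * k + a + 1) x / (θ * k + a + 1)
      = Real.exp x * x ^ a * (edgeCoeff (alp θ a + 1) m k * uGamma (-(θ * k) - a) x
        * x ^ (θ * k) / (θ * k + a + 1)) := fun k _ => by
    have : 0 ≤ θ * k := by positivity
    rw [gammaStieltjes_eq (by linarith) hx, show θ * k + a + 1 - 1 = a + θ * k by ring,
      show 1 - (θ * k + a + 1) = -(θ * k) - a by ring, Real.rpow_add hx]
    ring
  have hexp : Real.exp (-x) * Real.exp x = 1 := by rw [← Real.exp_add]; simp
  rw [vFun_eq, Finset.sum_congr rfl hterm, ← Finset.mul_sum,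
    show 2 * a + 1 = a + a + 1 by ring, Real.rpow_add_one hx.ne', Real.rpow_add hx]
  linear_combination (θ * x * x ^ a * x ^ a * ∑ k ∈ Finset.range m, edgeCoeff (alp θ a + 1) m k
    * uGamma (-(θ * k) - a) x * x ^ (θ * k) / (θ * k + a + 1)) * hexp

/-- **Kernel factorization (ii).** For every integer `m ≥ 1`, reals `θ > 0`,
`a > −1`, and all `x, y > 0`: `K₀₁(x,y) − K₁₀(y,x) = v(x)·w(y)`. -/
theorem K01_K10_factorization (m : ℕ) (hm : 1 ≤ m) (θ a : ℝ) (hθ : 0 < θ) (ha : -1 < a)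
    (x y : ℝ) (hx : 0 < x) (hy : 0 < y) :
    K01 m θ a x y - K10 m θ a y x = vFun m θ a x * wFun m θ a y := by
  have hs : ∀ k : ℕ, 0 < θ * k + a + 1 := fun k => by
    have : 0 ≤ θ * k := by positivity
    linarith
  have hb := alp_add_one_pos hθ ha
  have hθb := mul_alp_add_one a hθ
  rw [K01_eq m hθ ha hx, K10_eq m hθ ha hx, vFun_eq_gammaStieltjes m hθ ha hx, wFun_eq,
    Finset.sum_comm (s := Finset.range m) (t := Finset.range m)
      (f := fun k l : ℕ => θ * edgeCoeff (alp θ a + 1) m k * edgeCoeff (alp θ a + 1) m l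
        / (k + l + (alp θ a + 1)) * (y ^ (θ * l) / Real.Gamma (θ * l + a + 2))
        * gammaStieltjes (θ * k + a + 1) x),
    Real.rpow_add_one hx.ne', mul_assoc (x ^ a * Real.exp (-x)),
    show x ^ a * x * Real.exp (-x) = x ^ a * Real.exp (-x) * x by ring,
    mul_assoc (x ^ a * Real.exp (-x)), ← mul_sub, Finset.mul_sum, ← Finset.sum_sub_distrib]
  congr 1
  rw [← mul_assoc, Finset.mul_sum]
  refine Finset.sum_congr rfl fun l hl => ?_
  have hone := sum_edgeCoeff_div_mul hb (Finset.mem_range.1 hl)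
  conv_rhs => enter [1, 1, 1]; rw [← hone]
  rw [Finset.mul_sum, Finset.mul_sum, ← Finset.sum_sub_distrib, ← Finset.sum_sub_distrib,
    Finset.sum_mul, Finset.sum_mul]
  refine Finset.sum_congr rfl fun k _ => ?_
  have hk := hs k
  have hlpos := hs l
  have hhalf : ∀ n : ℕ, (n : ℝ) + (alp θ a + 1) / 2 = (θ * n + a + 1) / θ := fun n => by
    field_simp
    linear_combination hθb
  have hsum : (k : ℝ) + l + (alp θ a + 1) = ((θ * k + a + 1) + (θ * l + a + 1)) / θ := by
    field_simp
    linear_combination hθb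
  have hG := (Real.Gamma_pos_of_pos hlpos).ne'
  have hG2 : Real.Gamma (θ * l + a + 2) = (θ * l + a + 1) * Real.Gamma (θ * l + a + 1) := by
    rw [← Real.Gamma_add_one hlpos.ne']
    ring_nf
  rw [show θ * k + a + 2 = θ * k + a + 1 + 1 by ring, gammaStieltjes_add_one hk hx, hG2,
    add_comm (l : ℝ) k, hsum, hhalf, hhalf]
  generalize θ * (k : ℝ) + a + 1 = p at *
  generalize θ * (l : ℝ) + a + 1 = q at *
  field_simp
  ring

end
end

section
/- For all integers n ≥ m ≥ 1, with d = m(2n−m)/2 and A(k) = (k+2n−2m+2)(k+2n−2m+1) Γ(k+3) / ((k+2n−m+2)(k+2n−m+1) Γ(k+3−m)), one has Σ_{k=0}^{m−1} (−1)^{k+m−1} (k+n−m+3/2)² A(k) / (2 d (d+1) (m−1−k)! k!) = (2n(2n+m) − m² + 1)/(2n(2mn − m² + 2)). (This is the θ = 1, a = n−m−1/2 specialization of the mean-purity formula for the quantum interpolating ensemble, i.e. the mean purity of the Bures–Hall ensemble.) -/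
open Finset

/-- **Mean purity of the Bures–Hall ensemble** (the `θ = 1`, `a = n−m−1/2`
specialization of the mean-purity formula of the quantum interpolating ensemble).
For all integers `n ≥ m ≥ 1`, with `d = m(2n−m)/2` and
`A(k) = (k+2n−2m+2)(k+2n−2m+1) Γ(k+3) / ((k+2n−m+2)(k+2n−m+1) Γ(k+3−m))`
(where the reciprocal of a Gamma factor at a nonpositive integer is interpreted
as `0`, which is the value `Real.Gamma` takes there),
`Σ_{k=0}^{m−1} (−1)^{k+m−1} (k+n−m+3/2)² A(k) / (2 d (d+1) (m−1−k)! k!)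
  = (2n(2n+m) − m² + 1)/(2n(2mn − m² + 2))`. -/
theorem bures_hall_mean_purity (m n : ℕ) (hm : 1 ≤ m) (hmn : m ≤ n) :
    (∑ k ∈ Finset.range m,
      (-1 : ℝ) ^ (k + m - 1) * ((k : ℝ) + n - m + 3 / 2) ^ 2
        * (((k : ℝ) + 2 * n - 2 * m + 2) * ((k : ℝ) + 2 * n - 2 * m + 1)
              * Real.Gamma ((k : ℝ) + 3)
            / (((k : ℝ) + 2 * n - m + 2) * ((k : ℝ) + 2 * n - m + 1)
              * Real.Gamma ((k : ℝ) + 3 - m)))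
        / (2 * ((m : ℝ) * (2 * n - m) / 2) * ((m : ℝ) * (2 * n - m) / 2 + 1)
            * (Nat.factorial (m - 1 - k)) * (Nat.factorial k)))
      = (2 * (n : ℝ) * (2 * n + m) - (m : ℝ) ^ 2 + 1)
          / (2 * (n : ℝ) * (2 * (m : ℝ) * n - (m : ℝ) ^ 2 + 2)) := by
  have hn : (m : ℝ) ≤ n := by exact_mod_cast hmn
  obtain ⟨p, rfl⟩ : ∃ p, m = p + 1 := ⟨m - 1, by omega⟩
  rcases p with _ | p
  · have hn1 : (1 : ℝ) ≤ n := by simpa using hn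
    have hG3 : Real.Gamma 3 = 2 := by
      have h := Real.Gamma_nat_eq_factorial 2
      rw [show ((2 : ℕ) : ℝ) + 1 = 3 by norm_num] at h
      rw [h]
      norm_num
    have hG2 : Real.Gamma (3 - 1) = 1 := by
      norm_num
    have h1 : (2 * (n : ℝ) - 1) ≠ 0 := by linarith
    have h2 : (n : ℝ) ≠ 0 := by linarith
    have h3 : (2 * (n : ℝ) + 1) ≠ 0 := by linarith
    simp only [zero_add, Finset.sum_range_one, Nat.cast_one, Nat.cast_zero, hG3, hG2,
      Nat.sub_self, pow_zero, Nat.factorial_zero, one_mul, mul_one]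
    rw [show 2 * (n : ℝ) - 2 + 2 = 2 * n by ring,
      show 2 * (n : ℝ) - 2 + 1 = 2 * n - 1 by ring,
      show 2 * (n : ℝ) - 1 + 2 = 2 * n + 1 by ring,
      show 2 * (n : ℝ) - 1 + 1 = 2 * n by ring,
      show (2 * (n : ℝ) - 1) / 2 + 1 = (2 * n + 1) / 2 by ring,
      show 2 * (n : ℝ) - 1 ^ 2 + 2 = 2 * n + 1 by ring]
    generalize ha : 2 * (n : ℝ) - 1 = a at *
    generalize hb : 2 * (n : ℝ) + 1 = b at *
    field_simp
    subst hb
    ring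
  · rw [Finset.sum_range_succ, Finset.sum_range_succ, Finset.sum_eq_zero]
    · have hG1 : Real.Gamma ((p : ℝ) + 3) = (p + 2) * ((p + 1) * (p.factorial : ℝ)) := by
        have h := Real.Gamma_nat_eq_factorial (p + 2)
        push_cast [Nat.factorial_succ] at h
        rw [show (p : ℝ) + 3 = p + 2 + 1 by ring, h]
        ring
      have hG2 : Real.Gamma (((p + 1 : ℕ) : ℝ) + 3)
          = (p + 3) * ((p + 2) * ((p + 1) * (p.factorial : ℝ))) := by
        have h := Real.Gamma_nat_eq_factorial (p + 3)
        push_cast [Nat.factorial_succ] at h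
        rw [show ((p + 1 : ℕ) : ℝ) + 3 = p + 3 + 1 by push_cast; ring, h]
        ring
      have hG3 : Real.Gamma ((p : ℝ) + 3 - ((p + 1 + 1 : ℕ) : ℝ)) = 1 := by
        rw [show (p : ℝ) + 3 - ((p + 1 + 1 : ℕ) : ℝ) = 1 by push_cast; ring, Real.Gamma_one]
      have hG4 : Real.Gamma (((p + 1 : ℕ) : ℝ) + 3 - ((p + 1 + 1 : ℕ) : ℝ)) = 1 := by
        rw [show ((p + 1 : ℕ) : ℝ) + 3 - ((p + 1 + 1 : ℕ) : ℝ) = 2 by push_cast; ring,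
          Real.Gamma_two]
      have hs1 : (-1 : ℝ) ^ (p + (p + 1 + 1) - 1) = -1 :=
        Odd.neg_one_pow ⟨p, by omega⟩
      have hs2 : (-1 : ℝ) ^ (p + 1 + (p + 1 + 1) - 1) = 1 :=
        Even.neg_one_pow ⟨p + 1, by omega⟩
      rw [hG1, hG2, hG3, hG4, hs1, hs2, show p + 1 + 1 - 1 - p = 1 by omega,
        show p + 1 + 1 - 1 - (p + 1) = 0 by omega, Nat.factorial_succ p]
      push_cast at hn ⊢
      have hf : (p.factorial : ℝ) ≠ 0 := by positivity
      generalize (p.factorial : ℝ) = f at hf ⊢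
      have hp : (0 : ℝ) ≤ p := p.cast_nonneg
      generalize (p : ℝ) = x at *
      generalize (n : ℝ) = y at *
      have h0 : y ≠ 0 := by linarith
      have h1 : 2 * y - 1 ≠ 0 := by linarith
      have h2 : 2 * y + 1 ≠ 0 := by linarith
      have h3 : x + 1 ≠ 0 := by linarith
      have h4 : x + 2 ≠ 0 := by linarith
      have h5 : 2 * y - (x + 2) ≠ 0 := by linarith
      have h6 : (x + 2) * (2 * y - (x + 2)) + 2 ≠ 0 := by nlinarith
      rw [show x + 1 + 1 = x + 2 by ring,
        show x + 2 * y - (x + 2) + 2 = 2 * y by ring,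
        show x + 2 * y - (x + 2) + 1 = 2 * y - 1 by ring,
        show x + 1 + 2 * y - (x + 2) + 2 = 2 * y + 1 by ring,
        show x + 1 + 2 * y - (x + 2) + 1 = 2 * y by ring,
        show (x + 2) * (2 * y - (x + 2)) / 2 + 1 = ((x + 2) * (2 * y - (x + 2)) + 2) / 2 by ring,
        show 2 * (x + 2) * y - (x + 2) ^ 2 + 2 = (x + 2) * (2 * y - (x + 2)) + 2 by ring]
      simp only [Nat.factorial_zero, Nat.factorial_one, Nat.cast_one, mul_one]
      generalize hw : (x + 2) * (2 * y - (x + 2)) + 2 = w at *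
      generalize hz : 2 * y - (x + 2) = z at *
      generalize ha : 2 * y - 1 = a at *
      generalize hb : 2 * y + 1 = b at *
      field_simp
      subst ha hb hz
      ring
    · intro k hk
      obtain ⟨j, rfl⟩ : ∃ j, p = k + 1 + j := ⟨p - (k + 1), by
        have := Finset.mem_range.mp hk
        omega⟩
      have hG : Real.Gamma ((k : ℝ) + 3 - ((k + 1 + j + 1 + 1 : ℕ) : ℝ)) = 0 := by
        rw [show (k : ℝ) + 3 - ((k + 1 + j + 1 + 1 : ℕ) : ℝ) = -(j : ℝ) by push_cast; ring]
        exact Real.Gamma_neg_nat_eq_zero j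
      rw [hG]
      simp
end

section
/- For every integer m ≥ 1, all reals θ > 0, a > −1, and every integer k ≥ 1, the k-th moment of quantum purity over the quantum interpolating ensemble satisfies E_f[(Σ_{i=1}^m λ_i²)^k] = (Γ(d)/Γ(d+2k)) · E_h[(Σ_{i=1}^m x_i²)^k]. -/
open Finset MeasureTheory Set

noncomputable section

/-- The unconstrained interpolating weight on `[0,∞)^m`:
`h̃(x) = ∏_{i<j} ((x_i−x_j)/(x_i+x_j))·(x_i^θ−x_j^θ) · ∏_i x_i^a e^{−x_i}`. -/
def hWeight (m : ℕ) (θ a : ℝ) (x : Fin m → ℝ) : ℝ :=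
  (∏ p ∈ Finset.univ.filter (fun p : Fin m × Fin m => p.1 < p.2),
      ((x p.1 - x p.2) / (x p.1 + x p.2) * (x p.1 ^ θ - x p.2 ^ θ)))
    * ∏ i, x i ^ a * Real.exp (-(x i))

/-- The positive orthant `[0,∞)^m`. -/
def orthant (m : ℕ) : Set (Fin m → ℝ) := {x | ∀ i, 0 ≤ x i}

/-- The unconstrained average
`E_h[G] = (∫_{[0,∞)^m} G h̃)/(∫_{[0,∞)^m} h̃)`. -/
def Eh (m : ℕ) (θ a : ℝ) (G : (Fin m → ℝ) → ℝ) : ℝ :=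
  (∫ x in orthant m, G x * hWeight m θ a x) / (∫ x in orthant m, hWeight m θ a x)

/-- The density (up to normalization) of the quantum interpolating ensemble:
`Ṽ(λ) = ∏_{i<j} ((λ_i−λ_j)/(λ_i+λ_j))·(λ_i^θ−λ_j^θ) · ∏_i λ_i^a`. -/
def Vdens (m : ℕ) (θ a : ℝ) (lam : Fin m → ℝ) : ℝ :=
  (∏ p ∈ Finset.univ.filter (fun p : Fin m × Fin m => p.1 < p.2),
      ((lam p.1 - lam p.2) / (lam p.1 + lam p.2) * (lam p.1 ^ θ - lam p.2 ^ θ)))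
    * ∏ i, lam i ^ a

/-- Parametrization of the probability simplex: the first `m−1` coordinates
are free and the last one is `1 −` their sum. -/
def simplexExt (m : ℕ) (lam : Fin (m - 1) → ℝ) : Fin m → ℝ :=
  fun i => if h : (i : ℕ) < m - 1 then lam ⟨i, h⟩ else 1 - ∑ j, lam j

/-- The parameter domain `Δ = {λ ∈ [0,∞)^{m−1} : Σ λ_i ≤ 1}` of the simplex. -/
def simplexDom (m : ℕ) : Set (Fin (m - 1) → ℝ) :=
  {lam | (∀ i, 0 ≤ lam i) ∧ ∑ i, lam i ≤ 1}

/-- The constrained average over the quantum interpolating ensemble: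
`E_f[G] = (∫_Δ G(λ) Ṽ(λ) dλ)/(∫_Δ Ṽ(λ) dλ)`, where `λ` runs over the simplex
parametrized by its first `m−1` coordinates. -/
def Ef (m : ℕ) (θ a : ℝ) (G : (Fin m → ℝ) → ℝ) : ℝ :=
  (∫ l in simplexDom m, G (simplexExt m l) * Vdens m θ a (simplexExt m l))
    / (∫ l in simplexDom m, Vdens m θ a (simplexExt m l))

/-- The parameter `d = m(mθ − θ + 2a + 2)/2`. -/
def dPar (m : ℕ) (θ a : ℝ) : ℝ := m * (m * θ - θ + 2 * a + 2) / 2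

/-- The digamma function `ψ₀ = Γ'/Γ`. -/
def psi0 (x : ℝ) : ℝ := deriv Real.Gamma x / Real.Gamma x

lemma lintegral_eq_ofReal_pow_mul_lintegral_comp_smul (n : ℕ) (g : (Fin n → ℝ) → ENNReal)
    {s : ℝ} (hs : 0 < s) :
    ∫⁻ y, g y = ENNReal.ofReal (s ^ n) * ∫⁻ l, g (s • l) := by
  have h := lintegral_map_equiv (μ := volume) g
    (Homeomorph.smulOfNeZero s hs.ne' : (Fin n → ℝ) ≃ₜ (Fin n → ℝ)).toMeasurableEquiv
  have h2 := Measure.map_addHaar_smul (volume : Measure (Fin n → ℝ)) hs.ne'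
  have h3 : ⇑(Homeomorph.smulOfNeZero s hs.ne' : (Fin n → ℝ) ≃ₜ (Fin n → ℝ)).toMeasurableEquiv
      = fun y => s • y := rfl
  rw [h3, h2, lintegral_smul_measure] at h
  rw [← h, smul_eq_mul, ← mul_assoc, ← ENNReal.ofReal_mul (by positivity)]
  rw [Module.finrank_fin_fun, abs_of_pos (by positivity), mul_inv_cancel₀ (by positivity)]
  simp

lemma measurableSet_orthant (m : ℕ) : MeasurableSet (orthant m) := by
  unfold orthant
  measurability

lemma measurableSet_simplexDom (m : ℕ) : MeasurableSet (simplexDom m) := by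
  unfold simplexDom
  refine MeasurableSet.inter (s₁ := {l : Fin (m - 1) → ℝ | ∀ i, 0 ≤ l i})
    (s₂ := {l : Fin (m - 1) → ℝ | ∑ i, l i ≤ 1}) ?_ ?_
  · measurability
  · exact measurableSet_le (by fun_prop) (by fun_prop)

lemma simplexExt_succ (n : ℕ) (l : Fin n → ℝ) :
    simplexExt (n + 1) l = Fin.snoc l (1 - ∑ j, l j) := by
  funext i
  refine Fin.lastCases ?_ (fun j => ?_) i
  · simp [simplexExt]
  · simp [simplexExt]

lemma measurable_snoc (n : ℕ) {α : Type*} [MeasurableSpace α] {f : α → Fin n → ℝ} {g : α → ℝ}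
    (hf : Measurable f) (hg : Measurable g) :
    Measurable (fun x => (Fin.snoc (f x) (g x) : Fin (n + 1) → ℝ)) := by
  refine measurable_pi_iff.2 fun i => ?_
  refine Fin.lastCases ?_ (fun j => ?_) i
  · simpa using hg
  · simpa [Function.comp_def] using (measurable_pi_apply j).comp hf

lemma smul_simplexExt_mem_orthant_iff (n : ℕ) {s : ℝ} (hs : 0 < s) (l : Fin n → ℝ) :
    s • simplexExt (n + 1) l ∈ orthant (n + 1) ↔ l ∈ simplexDom (n + 1) := by
  simp only [orthant, simplexDom, simplexExt_succ, Set.mem_ofPred_eq, Fin.forall_fin_succ',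
    Pi.smul_apply, smul_eq_mul, Fin.snoc_castSucc, Fin.snoc_last, mul_nonneg_iff_of_pos_left hs,
    sub_nonneg]
  rfl

/-- Integration over the orthant in the coordinates `x = s • λ` with `s > 0` and `λ` in the
simplex. -/
lemma setLIntegral_orthant_eq (n : ℕ) {F : (Fin (n + 1) → ℝ) → ENNReal} (hF : Measurable F) :
    ∫⁻ x in orthant (n + 1), F x = ∫⁻ s in Ioi (0 : ℝ), ENNReal.ofReal (s ^ n) *
      ∫⁻ l in simplexDom (n + 1), F (s • simplexExt (n + 1) l) := by
  set H := (orthant (n + 1)).indicator F with hH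
  have hHm : Measurable H := hF.indicator (measurableSet_orthant _)
  have hsnoc : Measurable (fun q : (Fin n → ℝ) × ℝ => H (Fin.snoc q.1 (q.2 - ∑ j, q.1 j))) :=
    hHm.comp (measurable_snoc n measurable_fst (by fun_prop))
  have split : ∫⁻ x, H x = ∫⁻ y : Fin n → ℝ, ∫⁻ t : ℝ, H (Fin.snoc y t) := by
    have h := (volume_preserving_piFinSuccAbove (fun _ : Fin (n + 1) => ℝ) (Fin.last n)).symm
    rw [MeasurePreserving.lintegral_map_equiv H _ h, Measure.volume_eq_prod,
      lintegral_prod_symm (fun q => H (MeasurableEquiv.symm _ q))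
        (hHm.comp (MeasurableEquiv.measurable _)).aemeasurable]
    refine lintegral_congr fun y => lintegral_congr fun t => ?_
    congr 1
    exact Fin.insertNth_last' t y
  have radial : ∀ s : ℝ, 0 < s → ∫⁻ y : Fin n → ℝ, H (Fin.snoc y (s - ∑ j, y j))
      = ENNReal.ofReal (s ^ n) *
        ∫⁻ l in simplexDom (n + 1), F (s • simplexExt (n + 1) l) := by
    intro s hs
    rw [lintegral_eq_ofReal_pow_mul_lintegral_comp_smul n _ hs,
      ← lintegral_indicator (measurableSet_simplexDom _)]
    congr 1
    refine lintegral_congr fun l => ?_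
    have hl : (Fin.snoc (s • l) (s - ∑ j, (s • l) j) : Fin (n + 1) → ℝ)
        = s • simplexExt (n + 1) l := by
      rw [simplexExt_succ]
      funext i
      refine Fin.lastCases ?_ (fun j => ?_) i
      · simp [mul_sub, Finset.mul_sum]
      · simp
    rw [hl, hH]
    by_cases h : l ∈ simplexDom (n + 1)
    · rw [Set.indicator_of_mem h,
        Set.indicator_of_mem ((smul_simplexExt_mem_orthant_iff n hs l).2 h)]
    · rw [Set.indicator_of_notMem h,
        Set.indicator_of_notMem (mt (smul_simplexExt_mem_orthant_iff n hs l).1 h)]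
  have vanish : ∀ s : ℝ, s < 0 → ∀ y : Fin n → ℝ, H (Fin.snoc y (s - ∑ j, y j)) = 0 := by
    intro s hs y
    refine Set.indicator_of_notMem (fun h => ?_) _
    simp only [orthant, Set.mem_ofPred_eq, Fin.forall_fin_succ', Fin.snoc_castSucc,
      Fin.snoc_last] at h
    have := Finset.sum_nonneg fun j (_ : j ∈ Finset.univ) => h.1 j
    linarith [h.2]
  calc ∫⁻ x in orthant (n + 1), F x = ∫⁻ x, H x :=
        (lintegral_indicator (measurableSet_orthant _) _).symm
    _ = ∫⁻ y : Fin n → ℝ, ∫⁻ s : ℝ, H (Fin.snoc y (s - ∑ j, y j)) := by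
        rw [split]
        exact lintegral_congr fun y =>
          (lintegral_sub_right_eq_self (fun t => H (Fin.snoc y t)) _).symm
    _ = ∫⁻ s : ℝ, ∫⁻ y : Fin n → ℝ, H (Fin.snoc y (s - ∑ j, y j)) :=
        lintegral_lintegral_swap hsnoc.aemeasurable
    _ = ∫⁻ s in Ioi (0 : ℝ), ∫⁻ y : Fin n → ℝ, H (Fin.snoc y (s - ∑ j, y j)) := by
        rw [← setLIntegral_univ, ← Set.Iio_union_Ici (a := (0 : ℝ)),
          lintegral_union measurableSet_Ici (Set.Iio_disjoint_Ici le_rfl),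
          setLIntegral_congr_fun measurableSet_Iio (g := fun _ => 0)
            (fun s hs => by simp [vanish s hs]),
          lintegral_zero, zero_add, setLIntegral_congr Ioi_ae_eq_Ici.symm]
    _ = _ := setLIntegral_congr_fun measurableSet_Ioi radial

lemma setIntegral_orthant_homogeneous (n : ℕ) {W : (Fin (n + 1) → ℝ) → ℝ} {p : ℝ}
    (hW : Measurable W) (h0 : ∀ x ∈ orthant (n + 1), 0 ≤ W x) (hp : 0 < n + 1 + p)
    (hhom : ∀ s > 0, ∀ x ∈ orthant (n + 1), W (s • x) = s ^ p * W x) :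
    ∫ x in orthant (n + 1), W x * Real.exp (-∑ i, x i)
      = Real.Gamma (n + 1 + p) * ∫ l in simplexDom (n + 1), W (simplexExt (n + 1) l) := by
  have hmem : ∀ l ∈ simplexDom (n + 1), simplexExt (n + 1) l ∈ orthant (n + 1) := fun l hl => by
    simpa using (smul_simplexExt_mem_orthant_iff n one_pos l).2 hl
  have hext : Measurable (simplexExt (n + 1)) := by
    have : simplexExt (n + 1) = fun l : Fin n → ℝ =>
      (Fin.snoc l (1 - ∑ j, l j) : Fin (n + 1) → ℝ) := funext (simplexExt_succ n)
    rw [this]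
    exact measurable_snoc n measurable_id (by fun_prop)
  have hsum : ∀ l : Fin n → ℝ, ∑ i, simplexExt (n + 1) l i = 1 := fun l => by
    rw [simplexExt_succ, Fin.sum_univ_castSucc]
    simp
  rw [integral_eq_lintegral_of_nonneg_ae
      (ae_restrict_of_forall_mem (measurableSet_orthant _) fun x hx =>
        mul_nonneg (h0 x hx) (Real.exp_pos _).le)
      (by fun_prop),
    integral_eq_lintegral_of_nonneg_ae
      (ae_restrict_of_forall_mem (measurableSet_simplexDom _) fun l hl => h0 _ (hmem l hl))
      (hW.comp hext).aestronglyMeasurable,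
    setLIntegral_orthant_eq n (by fun_prop), Real.Gamma_eq_integral hp,
    ← ENNReal.toReal_ofReal (r := ∫ x in Ioi (0 : ℝ), Real.exp (-x) * x ^ ((n : ℝ) + 1 + p - 1))
      (setIntegral_nonneg measurableSet_Ioi fun x (hx : 0 < x) => by positivity),
    ← ENNReal.toReal_mul,
    ofReal_integral_eq_lintegral_ofReal (Real.GammaIntegral_convergent hp)
      (ae_restrict_of_forall_mem measurableSet_Ioi fun x (hx : 0 < x) => by positivity),
    ← lintegral_mul_const _ (by fun_prop)]
  congr 1
  refine setLIntegral_congr_fun measurableSet_Ioi fun s (hs : 0 < s) => ?_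
  have inner : ∀ l ∈ simplexDom (n + 1),
      ENNReal.ofReal (W (s • simplexExt (n + 1) l)
        * Real.exp (-∑ i, (s • simplexExt (n + 1) l) i))
      = ENNReal.ofReal (s ^ p * Real.exp (-s)) * ENNReal.ofReal (W (simplexExt (n + 1) l)) := by
    intro l hl
    rw [hhom s hs _ (hmem l hl), ← ENNReal.ofReal_mul (by positivity)]
    simp only [Pi.smul_apply, smul_eq_mul, ← Finset.mul_sum, hsum, mul_one]
    ring_nf
  rw [setLIntegral_congr_fun (measurableSet_simplexDom _) inner,
    lintegral_const_mul _ (f := fun l => ENNReal.ofReal (W (simplexExt (n + 1) l)))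
      (hW.comp hext).ennreal_ofReal, ← mul_assoc,
    ← ENNReal.ofReal_mul (by positivity)]
  congr 2
  rw [show (n : ℝ) + 1 + p - 1 = n + p by ring, Real.rpow_add hs, Real.rpow_natCast]
  ring

lemma card_filter_lt_fin (m : ℕ) :
    ((Finset.univ.filter (fun p : Fin m × Fin m => p.1 < p.2)).card : ℝ)
      = m * (m - 1) / 2 := by
  have h : (Finset.univ.filter (fun p : Fin m × Fin m => p.1 < p.2)).card
      = ∑ i ∈ Finset.range m, i := by
    rw [Finset.card_filter, Fintype.sum_prod_type_right, ← Fin.sum_univ_eq_sum_range]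
    refine Finset.sum_congr rfl fun j _ => ?_
    rw [← Finset.card_filter, Finset.filter_gt_eq_Iio, Fin.card_Iio]
  rw [h]
  clear h
  push_cast
  induction m with
  | zero => simp
  | succ m ih =>
    rw [Finset.sum_range_succ, ih]
    push_cast
    ring

lemma measurable_Vdens (m : ℕ) (θ a : ℝ) : Measurable (Vdens m θ a) := by
  unfold Vdens
  fun_prop

lemma Vdens_nonneg (m : ℕ) {θ : ℝ} (a : ℝ) (hθ : 0 < θ) {x : Fin m → ℝ} (hx : x ∈ orthant m) :
    0 ≤ Vdens m θ a x := by
  refine mul_nonneg (Finset.prod_nonneg fun p _ => ?_)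
    (Finset.prod_nonneg fun i _ => Real.rpow_nonneg (hx i) _)
  have h1 := hx p.1
  have h2 := hx p.2
  rw [div_mul_eq_mul_div]
  refine div_nonneg ?_ (add_nonneg h1 h2)
  rcases le_total (x p.1) (x p.2) with h | h
  · exact mul_nonneg_of_nonpos_of_nonpos (sub_nonpos.2 h)
      (sub_nonpos.2 (Real.rpow_le_rpow h1 h hθ.le))
  · exact mul_nonneg (sub_nonneg.2 h) (sub_nonneg.2 (Real.rpow_le_rpow h2 h hθ.le))

lemma Vdens_smul (m : ℕ) (θ a : ℝ) {s : ℝ} (hs : 0 < s) {x : Fin m → ℝ} (hx : x ∈ orthant m) :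
    Vdens m θ a (s • x) = s ^ (dPar m θ a - m) * Vdens m θ a x := by
  have hpair : ∀ p : Fin m × Fin m,
      ((s • x) p.1 - (s • x) p.2) / ((s • x) p.1 + (s • x) p.2)
          * ((s • x) p.1 ^ θ - (s • x) p.2 ^ θ)
        = s ^ θ * ((x p.1 - x p.2) / (x p.1 + x p.2) * (x p.1 ^ θ - x p.2 ^ θ)) := by
    intro p
    simp only [Pi.smul_apply, smul_eq_mul]
    rw [Real.mul_rpow hs.le (hx _), Real.mul_rpow hs.le (hx _), ← mul_sub, ← mul_sub, ← mul_add,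
      mul_div_mul_left _ _ hs.ne']
    ring
  have hone : ∀ i, (s • x) i ^ a = s ^ a * x i ^ a := fun i => by
    rw [Pi.smul_apply, smul_eq_mul, Real.mul_rpow hs.le (hx _)]
  unfold Vdens
  simp only [hpair, hone, Finset.prod_mul_distrib, Finset.prod_const, Finset.card_univ,
    Fintype.card_fin]
  have hexp : s ^ (dPar m θ a - m)
      = (s ^ θ) ^ (Finset.univ.filter (fun p : Fin m × Fin m => p.1 < p.2)).card * (s ^ a) ^ m := by
    rw [← Real.rpow_mul_natCast hs.le, ← Real.rpow_mul_natCast hs.le, ← Real.rpow_add hs,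
      card_filter_lt_fin]
    congr 1
    unfold dPar
    ring
  rw [hexp]
  ring

lemma hWeight_eq_Vdens_mul_exp (m : ℕ) (θ a : ℝ) (x : Fin m → ℝ) :
    hWeight m θ a x = Vdens m θ a x * Real.exp (-∑ i, x i) := by
  unfold hWeight Vdens
  rw [Finset.prod_mul_distrib (f := fun i => x i ^ a), ← Finset.sum_neg_distrib, Real.exp_sum,
    mul_assoc]

lemma dPar_pos {m : ℕ} (hm : 1 ≤ m) {θ a : ℝ} (hθ : 0 < θ) (ha : -1 < a) : 0 < dPar m θ a := by
  have hm' : (1 : ℝ) ≤ m := by exact_mod_cast hm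
  unfold dPar
  have : 0 ≤ (m - 1) * θ := mul_nonneg (by linarith) hθ.le
  have : 0 < m * θ - θ + 2 * a + 2 := by linarith
  positivity

/-- The orthant integral of a purity power is a Gamma multiple of its simplex integral; the case
`k = 0` relates the two normalizations. -/
lemma setIntegral_purity_pow_mul_hWeight {m : ℕ} (hm : 1 ≤ m) {θ a : ℝ} (hθ : 0 < θ)
    (ha : -1 < a) (k : ℕ) :
    ∫ x in orthant m, (∑ i, x i ^ 2) ^ k * hWeight m θ a x
      = Real.Gamma (dPar m θ a + 2 * k) * ∫ l in simplexDom m,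
          (∑ i, simplexExt m l i ^ 2) ^ k * Vdens m θ a (simplexExt m l) := by
  obtain ⟨n, rfl⟩ : ∃ n, m = n + 1 := ⟨m - 1, by omega⟩
  have hd := dPar_pos hm hθ ha
  have hdeg : dPar (n + 1) θ a + 2 * k = n + 1 + (dPar (n + 1) θ a - (n + 1 : ℕ) + 2 * k) := by
    push_cast
    ring
  simp only [hWeight_eq_Vdens_mul_exp, ← mul_assoc]
  rw [hdeg]
  refine setIntegral_orthant_homogeneous n
    (W := fun x => (∑ i, x i ^ 2) ^ k * Vdens (n + 1) θ a x) ?_ ?_ ?_ ?_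
  · have := measurable_Vdens (n + 1) θ a
    fun_prop
  · intro x hx
    exact mul_nonneg (by positivity) (Vdens_nonneg _ a hθ hx)
  · rw [← hdeg]
    positivity
  · intro s hs x hx
    have hsq : ∑ i, (s • x) i ^ 2 = s ^ 2 * ∑ i, x i ^ 2 := by
      simp [mul_pow, Finset.mul_sum]
    have hk : s ^ (2 * k : ℝ) = (s ^ 2) ^ k := by
      rw [← pow_mul, ← Real.rpow_natCast]
      push_cast
      rfl
    rw [hsq, Vdens_smul _ θ a hs hx, Real.rpow_add hs, hk, mul_pow]
    ring

/-- **Moment relation for quantum purity.** For every integer `m ≥ 1`, reals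
`θ > 0`, `a > −1`, and every integer `k ≥ 1`, with `d = m(mθ−θ+2a+2)/2`:
`E_f[(Σ λ_i²)^k] = (Γ(d)/Γ(d+2k)) · E_h[(Σ x_i²)^k]`. -/
theorem purity_moment_relation (m : ℕ) (hm : 1 ≤ m) (θ a : ℝ)
    (hθ : 0 < θ) (ha : -1 < a) (k : ℕ) (hk : 1 ≤ k) :
    Ef m θ a (fun lam => (∑ i, lam i ^ 2) ^ k)
      = Real.Gamma (dPar m θ a) / Real.Gamma (dPar m θ a + 2 * k)
          * Eh m θ a (fun x => (∑ i, x i ^ 2) ^ k) := by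
  have hd := dPar_pos hm hθ ha
  have hd0 := (Real.Gamma_pos_of_pos hd).ne'
  have hdk := (Real.Gamma_pos_of_pos (show 0 < dPar m θ a + 2 * k by positivity)).ne'
  have hnum := setIntegral_purity_pow_mul_hWeight hm hθ ha k
  have hden := setIntegral_purity_pow_mul_hWeight hm hθ ha 0
  simp only [pow_zero, one_mul, Nat.cast_zero, mul_zero, add_zero] at hden
  unfold Ef Eh
  rw [hnum, hden, div_mul_div_comm, mul_left_comm,
    mul_div_mul_left _ _ hdk, mul_div_mul_left _ _ hd0]

end
end

section
/- For every integer m ≥ 1, all reals θ > 0, a > −1 with α = 2(a+1)/θ − 1, and every integer i with 0 ≤ i ≤ m−1, the following terminating Saalschützian hypergeometric identity holds: Σ_{k=0}^{m−1} (−1)^k Γ(k+α+m+1) / ( (i+k+α+1)(θk+a+1) Γ(k+α+1) (m−1−k)! k! ) = 1/(θi+a+1). -/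
open Finset

/-- The product of the differences between one of the nodes `0, …, k + d` and all others. -/
theorem prod_erase_range_sub_natCast (k d : ℕ) :
    ∏ j ∈ (range (k + d + 1)).erase k, ((k : ℝ) - j) =
      (-1) ^ d * (Nat.factorial k * Nat.factorial d) := by
  induction d with
  | zero =>
    have h : (range (k + 0 + 1)).erase k = range k := by
      ext x; simp only [mem_erase, mem_range]; omega
    rw [h, ← prod_range_reflect, ← prod_range_add_one_eq_factorial]
    push_cast
    simp only [pow_zero, one_mul, Nat.factorial_zero, Nat.cast_one, mul_one]
    refine prod_congr rfl fun j hj => ?_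
    have hj' := mem_range.mp hj
    rw [Nat.cast_sub (by omega), Nat.cast_sub (by omega)]
    push_cast; ring
  | succ d ih =>
    have h : (range (k + (d + 1) + 1)).erase k =
        insert (k + d + 1) ((range (k + d + 1)).erase k) := by
      ext x; simp only [mem_erase, mem_range, mem_insert]; omega
    rw [h, prod_insert (by simp), ih, Nat.factorial_succ]
    push_cast; ring

/-- Barycentric interpolation at the nodes `0, …, n`, evaluated at a negative point `-b`. -/
theorem sum_eval_natCast_div_eq (n : ℕ) (Q : Polynomial ℝ) (hQ : Q.degree < (n + 1 : ℕ))
    (b : ℝ) (hb : 0 < b) :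
    ∑ k ∈ range (n + 1), (-1 : ℝ) ^ k * Q.eval (k : ℝ) /
        ((b + k) * (Nat.factorial (n - k) * Nat.factorial k)) =
      Q.eval (-b) / ∏ l ∈ range (n + 1), (b + l) := by
  have hinj : Set.InjOn (fun k : ℕ => (k : ℝ)) (range (n + 1)) :=
    Nat.cast_injective.injOn
  have hne : ∀ k ∈ range (n + 1), -b ≠ (k : ℝ) := fun k _ => by
    have : (0 : ℝ) ≤ k := k.cast_nonneg
    linarith
  have hprod : ∏ l ∈ range (n + 1), (b + l) ≠ 0 :=
    prod_ne_zero_iff.mpr fun l _ => by positivity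
  have key := Lagrange.eval_interpolate_not_at_node
    (v := fun k : ℕ => (k : ℝ)) (fun k : ℕ => Q.eval (k : ℝ)) hne
  rw [← Lagrange.eq_interpolate hinj (by rwa [card_range])] at key
  have hnodal : ∏ l ∈ range (n + 1), (-b - (l : ℝ)) =
      (-1) ^ (n + 1) * ∏ l ∈ range (n + 1), (b + l) := by
    rw [← card_range (n + 1), ← prod_const, card_range, ← prod_mul_distrib]
    exact prod_congr rfl fun l _ => by ring
  rw [eq_div_iff hprod, key, Lagrange.eval_nodal, hnodal, mul_comm, mul_comm ((-1) ^ (n + 1)),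
    mul_assoc]
  congr 1
  rw [mul_sum]
  refine sum_congr rfl fun k hk => ?_
  obtain ⟨d, rfl⟩ := Nat.exists_eq_add_of_le (Nat.lt_succ_iff.mp (mem_range.mp hk))
  rw [Lagrange.nodalWeight, prod_inv_distrib, prod_erase_range_sub_natCast,
    Nat.add_sub_cancel_left, show -b - (k : ℝ) = -(b + k) by ring]
  have hbk : b + k ≠ 0 := by positivity
  have hsq : ((-1 : ℝ) ^ d) * (-1) ^ d = 1 := by rw [← mul_pow]; simp
  have hd : ((-1 : ℝ) ^ d)⁻¹ = (-1) ^ d := inv_eq_of_mul_eq_one_left hsq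
  rw [mul_inv, hd, inv_neg, div_eq_mul_inv, mul_inv, mul_comm (Nat.factorial d : ℝ)]
  linear_combination (-(-1 : ℝ) ^ k * (b + k)⁻¹ *
    (Nat.factorial k * Nat.factorial d : ℝ)⁻¹ * Q.eval (k : ℝ)) * hsq

theorem Real.Gamma_add_natCast_eq_prod_mul {x : ℝ} (hx : 0 < x) (n : ℕ) :
    Real.Gamma (x + n) = (∏ j ∈ range n, (x + j)) * Real.Gamma x := by
  induction n with
  | zero => simp
  | succ n ih =>
    rw [Nat.cast_succ, ← add_assoc, Real.Gamma_add_one (by positivity), ih, prod_range_succ]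
    ring


/-- **Terminating Saalschützian ₄F₃ identity.** For every integer `m ≥ 1`,
reals `θ > 0`, `a > −1` with `α = 2(a+1)/θ − 1`, and every integer
`0 ≤ i ≤ m−1`:
`Σ_{k=0}^{m−1} (−1)^k Γ(k+α+m+1) / ((i+k+α+1)(θk+a+1) Γ(k+α+1) (m−1−k)! k!)
  = 1/(θi+a+1)`. -/
theorem saalschuetz_identity (m : ℕ) (hm : 1 ≤ m) (θ a : ℝ) (hθ : 0 < θ)
    (ha : -1 < a) (i : ℕ) (hi : i < m) :
    (∑ k ∈ Finset.range m,
        (-1 : ℝ) ^ k * Real.Gamma ((k : ℝ) + (2 * (a + 1) / θ - 1) + m + 1)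
          / (((i : ℝ) + k + (2 * (a + 1) / θ - 1) + 1) * (θ * k + a + 1)
              * Real.Gamma ((k : ℝ) + (2 * (a + 1) / θ - 1) + 1)
              * (Nat.factorial (m - 1 - k)) * (Nat.factorial k)))
      = 1 / (θ * i + a + 1) := by
  obtain ⟨n, rfl⟩ := Nat.exists_eq_add_of_le' hm
  have hi' : i ∈ range (n + 1) := mem_range.mpr hi
  obtain ⟨b, hb⟩ : ∃ b, b = (a + 1) / θ := ⟨_, rfl⟩
  have hb0 : 0 < b := hb ▸ div_pos (by linarith) hθ
  have hab : a + 1 = θ * b := by rw [hb]; field_simp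
  have hα : 2 * (a + 1) / θ - 1 = 2 * b - 1 := by rw [hb]; ring
  rw [hα, add_assoc _ a, hab, ← mul_add]
  let Q : Polynomial ℝ := Lagrange.nodal ((range (n + 1)).erase i) fun j : ℕ => -(2 * b + j)
  have hQ : Q.degree < (n + 1 : ℕ) := by
    rw [Lagrange.degree_nodal, card_erase_of_mem hi', card_range]
    exact_mod_cast Nat.lt_succ_self n
  have hQe (x : ℝ) : Q.eval x = ∏ j ∈ (range (n + 1)).erase i, (x + 2 * b + j) := by
    rw [Lagrange.eval_nodal]
    exact prod_congr rfl fun j _ => by ring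
  have hbi : b + i ≠ 0 := by positivity
  have hres : Q.eval (-b) / ∏ l ∈ range (n + 1), (b + (l : ℝ)) = 1 / (b + i) := by
    have hne : ∏ l ∈ (range (n + 1)).erase i, (b + (l : ℝ)) ≠ 0 :=
      prod_ne_zero_iff.mpr fun l _ => by positivity
    rw [hQe, ← mul_prod_erase _ _ hi', show -b + 2 * b = b by ring]
    field_simp
  have hsum := sum_eval_natCast_div_eq n Q hQ b hb0
  rw [hres] at hsum
  rw [add_comm (i : ℝ), ← div_div, div_right_comm, ← hsum, sum_div]
  refine sum_congr rfl fun k _ => ?_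
  have hx : 0 < (k : ℝ) + 2 * b := by positivity
  rw [show (k : ℝ) + (2 * b - 1) + (n + 1 : ℕ) + 1 = k + 2 * b + (n + 1 : ℕ) by ring,
    show (k : ℝ) + (2 * b - 1) + 1 = k + 2 * b by ring,
    show (i : ℝ) + k + (2 * b - 1) + 1 = k + 2 * b + i by ring,
    add_assoc (θ * (k : ℝ)), hab, ← mul_add, Real.Gamma_add_natCast_eq_prod_mul hx,
    ← mul_prod_erase _ _ hi', ← hQe, Nat.add_sub_cancel, add_comm (k : ℝ) b]
  have hG := (Real.Gamma_pos_of_pos hx).ne'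
  have hxi : (k : ℝ) + 2 * b + i ≠ 0 := by positivity
  have hbk : b + k ≠ 0 := by positivity
  field_simp
end

section
/- For every positive integer θ and all reals p > −1 and q > −1, the following Gamma-function identity holds: Γ(p+θ+1) Γ(q+1) − (−1)^θ Γ(p+1) Γ(q+θ+1) = (p+q+θ+1) · Σ_{s=0}^{θ−1} (−1)^s Γ(p+θ−s) Γ(q+1+s). (Equivalently, in terms of the Cauchy–Laguerre bimoments I_{k,l} = Γ(a+1+θk)Γ(b+1+θl)/(a+b+1+θ(k+l)) with p = a+θk, q = b+θl, this is the rank-θ shift relation I_{k+1,l} − e^{πiθ} I_{k,l+1} = Σ_{s=0}^{θ−1} (−1)^s Γ(a+θ−s+θk) Γ(b+1+s+θl).) -/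
open Finset

/-- **Rank-θ shift relation for Cauchy–Laguerre bimoments.**
For every positive integer `θ` and all reals `p > -1`, `q > -1`,
`Γ(p+θ+1) Γ(q+1) − (−1)^θ Γ(p+1) Γ(q+θ+1)
  = (p+q+θ+1) · Σ_{s=0}^{θ−1} (−1)^s Γ(p+θ−s) Γ(q+1+s)`. -/
theorem gamma_rank_theta_shift (θ : ℕ) (hθ : 1 ≤ θ) (p q : ℝ)
    (hp : -1 < p) (hq : -1 < q) :
    Real.Gamma (p + θ + 1) * Real.Gamma (q + 1)
      - (-1 : ℝ) ^ θ * Real.Gamma (p + 1) * Real.Gamma (q + θ + 1)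
    = (p + q + θ + 1) *
        ∑ s ∈ Finset.range θ,
          (-1 : ℝ) ^ s * Real.Gamma (p + θ - s) * Real.Gamma (q + 1 + s) := by
  have telescope := Finset.sum_range_sub'
    (fun s : ℕ ↦ (-1 : ℝ) ^ s * Real.Gamma (p + θ + 1 - s) * Real.Gamma (q + 1 + s)) θ
  have step : ∀ s ∈ Finset.range θ,
      (-1 : ℝ) ^ s * Real.Gamma (p + θ + 1 - s) * Real.Gamma (q + 1 + s)
        - (-1 : ℝ) ^ (s + 1) * Real.Gamma (p + θ + 1 - (s + 1 : ℕ))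
          * Real.Gamma (q + 1 + (s + 1 : ℕ))
      = (p + q + θ + 1) *
        ((-1 : ℝ) ^ s * Real.Gamma (p + θ - s) * Real.Gamma (q + 1 + s)) := by
    intro s hs
    have hsθ : (s : ℝ) + 1 ≤ θ := by exact_mod_cast Finset.mem_range.mp hs
    have hp' : p + θ - s ≠ 0 := by linarith
    have hq' : q + 1 + s ≠ 0 := by linarith [s.cast_nonneg (α := ℝ)]
    rw [show p + θ + 1 - (s : ℝ) = (p + θ - s) + 1 by ring,
      show p + θ + 1 - ((s + 1 : ℕ) : ℝ) = p + θ - s by push_cast; ring,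
      show q + 1 + ((s + 1 : ℕ) : ℝ) = (q + 1 + s) + 1 by push_cast; ring,
      Real.Gamma_add_one hp', Real.Gamma_add_one hq']
    ring
  rw [Finset.mul_sum, ← Finset.sum_congr rfl step, telescope]
  simp only [pow_zero, one_mul, Nat.cast_zero, sub_zero, add_zero]
  rw [show p + θ + 1 - (θ : ℝ) = p + 1 by ring, show q + 1 + (θ : ℝ) = q + θ + 1 by ring]
end
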